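/- Let ω₀ be a positive weight on ℝ^{2d} and a a smooth function with |a| ≤ C₀ ω₀. If (x₀,ξ₀) ∉ Char_{(ω₀)}(a), then there exists a bounded smooth function b supported in X × Γ (with X a neighbourhood of x₀ and Γ a conical neighbourhood of ξ₀), satisfying |b(x,ξ)| ≤ C/ω₀(x,ξ), such that a(x,ξ)·b(x,ξ) = φ(x)ψ(ξ) where φ is a cutoff equal to 1 near x₀ and ψ is a directional cutoff equal to 1 on a conical neighbourhood of ξ₀ for |ξ| ≥ R. In particular |a·b| ≥ 1/2 on a set of the form X' × {ξ ∈ Γ' : |ξ| ≥ R'}. -/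

import Mathlib

/-- A function that is smooth at every point of its closed support is smooth. -/
theorem contDiff_of_contDiffAt_tsupport {E F : Type*} [NormedAddCommGroup E] [NormedSpace ℝ E]
    [NormedAddCommGroup F] [NormedSpace ℝ F] {n : WithTop ℕ∞} {f : E → F}
    (h : ∀ x ∈ tsupport f, ContDiffAt ℝ n f x) : ContDiff ℝ n f := by
  refine contDiff_iff_contDiffAt.2 fun x => ?_
  by_cases hx : x ∈ tsupport f
  · exact h x hx
  · exact contDiffAt_const.congr_of_eventuallyEq (notMem_tsupport_iff_eventuallyEq.1 hx)

/-- A quotient is smooth when its denominator is smooth and does not vanish on the closed support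
of its numerator. -/
theorem ContDiff.div_of_ne_zero_on_tsupport {E : Type*} [NormedAddCommGroup E] [NormedSpace ℝ E]
    {n : WithTop ℕ∞} {f g : E → ℂ} (hf : ContDiff ℝ n f) (hg : ContDiff ℝ n g)
    (h : ∀ x ∈ tsupport f, g x ≠ 0) : ContDiff ℝ n (fun x => f x / g x) := by
  refine contDiff_of_contDiffAt_tsupport fun x hx => ?_
  simp only [div_eq_mul_inv]
  refine hf.contDiffAt.mul (hg.contDiffAt.inv (h x ?_))
  refine closure_mono (fun y hy => ?_) hx
  rw [Function.mem_support] at hy ⊢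
  exact fun h0 => hy (by simp [h0])

/-- Every neighbourhood of a point carries a smooth compactly supported cutoff that is `1` near
the point. -/
theorem exists_smooth_cutoff {E : Type*} [NormedAddCommGroup E] [NormedSpace ℝ E]
    [FiniteDimensional ℝ E] [HasContDiffBump E] {X : Set E} (hX : IsOpen X) {x₀ : E} (hx₀ : x₀ ∈ X) :
    ∃ φ : E → ℝ, ContDiff ℝ (⊤ : ℕ∞) φ ∧ HasCompactSupport φ ∧ (∀ x, 0 ≤ φ x ∧ φ x ≤ 1) ∧
      tsupport φ ⊆ X ∧ ∃ U : Set E, IsOpen U ∧ x₀ ∈ U ∧ ∀ x ∈ U, φ x = 1 := by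
  obtain ⟨r, hr, hrX⟩ := Metric.nhds_basis_closedBall.mem_iff.1 (hX.mem_nhds hx₀)
  let f : ContDiffBump x₀ := ⟨r / 2, r, half_pos hr, half_lt_self hr⟩
  refine ⟨f, f.contDiff, f.hasCompactSupport, fun x => ⟨f.nonneg, f.le_one⟩,
    f.tsupport_eq.trans_subset hrX, Metric.ball x₀ (r / 2), Metric.isOpen_ball,
    Metric.mem_ball_self (half_pos hr),
    fun x hx => f.one_of_mem_closedBall (Metric.ball_subset_closedBall hx)⟩

/-- Every open cone around a nonzero direction carries a smooth directional cutoff, supported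
outside a prescribed ball. -/
theorem exists_directional_cutoff {E : Type*} [NormedAddCommGroup E] [InnerProductSpace ℝ E]
    [FiniteDimensional ℝ E] {Γ : Set E} (hΓ : IsOpen Γ)
    (hcone : ∀ ξ ∈ Γ, ∀ t : ℝ, 0 < t → t • ξ ∈ Γ) {ξ₀ : E} (hξ₀ : ξ₀ ≠ 0) (hmem : ξ₀ ∈ Γ)
    {R : ℝ} (hR : 0 < R) :
    ∃ ψ : E → ℝ, ContDiff ℝ (⊤ : ℕ∞) ψ ∧ (∀ ξ, 0 ≤ ψ ξ ∧ ψ ξ ≤ 1) ∧ tsupport ψ ⊆ Γ ∧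
      (∀ ξ ∈ tsupport ψ, R ≤ ‖ξ‖) ∧
      (∀ ξ : E, ∀ t : ℝ, 1 ≤ t → R + 1 ≤ ‖ξ‖ → ψ (t • ξ) = ψ ξ) ∧
      ∃ Γ₁ : Set E, IsOpen Γ₁ ∧ ξ₀ ∈ Γ₁ ∧ (∀ ξ ∈ Γ₁, ∀ t : ℝ, 0 < t → t • ξ ∈ Γ₁) ∧
        ∀ ξ ∈ Γ₁, R + 1 ≤ ‖ξ‖ → ψ ξ = 1 := by
  have hu : ‖ξ₀‖⁻¹ • ξ₀ ∈ Γ := hcone _ hmem _ (by positivity)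
  obtain ⟨η, hη, -, hη01, hηΓ, U, hU, huU, hη1⟩ := exists_smooth_cutoff hΓ hu
  have hscale : ∀ (ξ : E) {t : ℝ}, 0 < t → ‖t • ξ‖⁻¹ • t • ξ = ‖ξ‖⁻¹ • ξ := fun ξ t ht => by
    rw [norm_smul, Real.norm_of_nonneg ht.le, smul_smul]
    congr 1
    field_simp
  have hχ1 : ∀ ξ : E, R + 1 ≤ ‖ξ‖ → Real.smoothTransition (‖ξ‖ ^ 2 - R ^ 2) = 1 := fun ξ hξ =>
    Real.smoothTransition.one_of_one_le (by nlinarith)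
  have hdir : ContinuousOn (fun ξ : E => ‖ξ‖⁻¹ • ξ) {0}ᶜ := fun ξ hξ =>
    ((continuousAt_id.norm.inv₀ (norm_ne_zero_iff.2 hξ)).smul continuousAt_id).continuousWithinAt
  set ψ : E → ℝ := fun ξ => Real.smoothTransition (‖ξ‖ ^ 2 - R ^ 2) * η (‖ξ‖⁻¹ • ξ)
  have hsupp : ∀ ξ ∈ tsupport ψ, R ≤ ‖ξ‖ := by
    refine closure_minimal (fun ξ hξ => ?_) (isClosed_le continuous_const continuous_norm)
    refine le_of_not_gt (α := ℝ) fun hlt => ?_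
    refine hξ (mul_eq_zero_of_left (Real.smoothTransition.zero_of_nonpos ?_) _)
    nlinarith [norm_nonneg ξ]
  have hne : ∀ ξ ∈ tsupport ψ, ξ ≠ 0 := fun ξ hξ => norm_pos_iff.1 (hR.trans_le (hsupp ξ hξ))
  refine ⟨ψ, contDiff_of_contDiffAt_tsupport fun ξ hξ => ?_, fun ξ => ⟨?_, ?_⟩, fun ξ hξ => ?_, hsupp,
    fun ξ t ht hξ => ?_, {0}ᶜ ∩ (fun ξ : E => ‖ξ‖⁻¹ • ξ) ⁻¹' U,
    hdir.isOpen_inter_preimage isOpen_compl_singleton hU, ⟨hξ₀, huU⟩, fun ξ hξ t ht => ?_,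
    fun ξ hξ hξR => ?_⟩
  · have h0 := hne ξ hξ
    refine ContDiffAt.mul ?_ ?_
    · exact (Real.smoothTransition.contDiff.comp
        ((contDiff_norm_sq ℝ).sub contDiff_const)).contDiffAt
    · exact hη.contDiffAt.comp ξ
        (((contDiffAt_norm ℝ h0).inv (norm_ne_zero_iff.2 h0)).smul contDiffAt_id)
  · exact mul_nonneg (Real.smoothTransition.nonneg _) (hη01 _).1
  · exact mul_le_one₀ (Real.smoothTransition.le_one _) (hη01 _).1 (hη01 _).2
  · have h0 := hne ξ hξ
    have hcont : ContinuousAt (fun ξ : E => ‖ξ‖⁻¹ • ξ) ξ :=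
      hdir.continuousAt (isOpen_compl_singleton.mem_nhds h0)
    have hmemη : ‖ξ‖⁻¹ • ξ ∈ tsupport η :=
      hcont.continuousWithinAt.mem_closure hξ fun y hy => right_ne_zero_of_mul hy
    simpa [smul_smul, norm_ne_zero_iff.2 h0] using
      hcone _ (hηΓ hmemη) ‖ξ‖ (norm_pos_iff.2 h0)
  · have htξ : R + 1 ≤ ‖t • ξ‖ := by
      rw [norm_smul, Real.norm_of_nonneg (zero_le_one.trans ht)]
      nlinarith
    simp only [ψ, hχ1 _ hξ, hχ1 _ htξ, hscale ξ (zero_lt_one.trans_le ht)]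
  · exact ⟨smul_ne_zero ht.ne' hξ.1, by simpa only [Set.mem_preimage, hscale ξ ht] using hξ.2⟩
  · simp only [ψ, hχ1 _ hξR, hη1 _ hξ.2, mul_one]


/-- if `|a| ≤ C₀ ω₀` and `(x₀,ξ₀) ∉ Char_{(ω₀)}(a)` (witnessed by the
explicit lower bound below), then there is a bounded smooth `b` supported in `X × Γ`
with `|b| ≤ C/ω₀` such that `a·b = φ ⊗ ψ` for a cutoff `φ` (≡1 near `x₀`) and a
directional cutoff `ψ`; in particular `|a·b| ≥ 1/2` on a set `X' × (Γ' ∩ {|ξ| ≥ R'})`. -/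
theorem stmt_13 {d : ℕ}
    (ω₀ : EuclideanSpace ℝ (Fin d) → EuclideanSpace ℝ (Fin d) → ℝ)
    (hω₀pos : ∀ x ξ, 0 < ω₀ x ξ)
    (a : EuclideanSpace ℝ (Fin d) → EuclideanSpace ℝ (Fin d) → ℂ)
    (ha : ContDiff ℝ (⊤ : ℕ∞) (fun p : EuclideanSpace ℝ (Fin d) × EuclideanSpace ℝ (Fin d) =>
      a p.1 p.2))
    (C₀ : ℝ) (hC₀ : 0 < C₀) (habd : ∀ x ξ, ‖a x ξ‖ ≤ C₀ * ω₀ x ξ)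
    (x₀ ξ₀ : EuclideanSpace ℝ (Fin d)) (hξ₀ : ξ₀ ≠ 0)
    -- (x₀,ξ₀) ∉ Char_{(ω₀)}(a):
    (hinv : ∃ (X Γ : Set (EuclideanSpace ℝ (Fin d))) (C R : ℝ),
      IsOpen X ∧ x₀ ∈ X ∧ IsOpen Γ ∧ ξ₀ ∈ Γ ∧
      (∀ ξ ∈ Γ, ∀ t : ℝ, 0 < t → t • ξ ∈ Γ) ∧ 0 < C ∧ 0 < R ∧
      ∀ x ∈ X, ∀ ξ ∈ Γ, R ≤ ‖ξ‖ → C * ω₀ x ξ ≤ ‖a x ξ‖) :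
    ∃ (b : EuclideanSpace ℝ (Fin d) → EuclideanSpace ℝ (Fin d) → ℂ)
      (φ ψ : EuclideanSpace ℝ (Fin d) → ℝ)
      (X Γ : Set (EuclideanSpace ℝ (Fin d))) (C R : ℝ),
      IsOpen X ∧ x₀ ∈ X ∧ IsOpen Γ ∧ ξ₀ ∈ Γ ∧
      (∀ ξ ∈ Γ, ∀ t : ℝ, 0 < t → t • ξ ∈ Γ) ∧ 0 < C ∧ 0 < R ∧
      -- b is smooth, bounded by C/ω₀ and supported in X × Γ:
      ContDiff ℝ (⊤ : ℕ∞) (fun p : EuclideanSpace ℝ (Fin d) × EuclideanSpace ℝ (Fin d) =>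
        b p.1 p.2) ∧
      (∀ x ξ, ‖b x ξ‖ ≤ C / ω₀ x ξ) ∧
      (∀ x ξ, x ∉ X ∨ ξ ∉ Γ → b x ξ = 0) ∧
      -- a·b = φ ⊗ ψ:
      (∀ x ξ, a x ξ * b x ξ = (φ x : ℂ) * (ψ ξ : ℂ)) ∧
      -- φ is a cutoff with respect to x₀ and X:
      ContDiff ℝ (⊤ : ℕ∞) φ ∧ HasCompactSupport φ ∧ (∀ x, 0 ≤ φ x ∧ φ x ≤ 1) ∧
      tsupport φ ⊆ X ∧
      (∃ U : Set (EuclideanSpace ℝ (Fin d)), IsOpen U ∧ x₀ ∈ U ∧ ∀ x ∈ U, φ x = 1) ∧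
      -- ψ is a directional cutoff with respect to ξ₀ and Γ:
      ContDiff ℝ (⊤ : ℕ∞) ψ ∧ (∀ ξ, 0 ≤ ψ ξ ∧ ψ ξ ≤ 1) ∧ tsupport ψ ⊆ Γ ∧
      (∀ ξ : EuclideanSpace ℝ (Fin d), ∀ t : ℝ, 1 ≤ t → R ≤ ‖ξ‖ → ψ (t • ξ) = ψ ξ) ∧
      (∃ Γ₁ : Set (EuclideanSpace ℝ (Fin d)), IsOpen Γ₁ ∧ ξ₀ ∈ Γ₁ ∧
        (∀ ξ ∈ Γ₁, ∀ t : ℝ, 0 < t → t • ξ ∈ Γ₁) ∧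
        ∀ ξ ∈ Γ₁, R ≤ ‖ξ‖ → ψ ξ = 1) ∧
      -- |a·b| ≥ 1/2 on X' × (Γ' ∩ {|ξ| ≥ R'}):
      (∃ (X' Γ' : Set (EuclideanSpace ℝ (Fin d))) (R' : ℝ),
        IsOpen X' ∧ x₀ ∈ X' ∧ IsOpen Γ' ∧ ξ₀ ∈ Γ' ∧
        (∀ ξ ∈ Γ', ∀ t : ℝ, 0 < t → t • ξ ∈ Γ') ∧ 0 < R' ∧
        ∀ x ∈ X', ∀ ξ ∈ Γ', R' ≤ ‖ξ‖ → (1 : ℝ) / 2 ≤ ‖a x ξ * b x ξ‖) := by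
  obtain ⟨X, Γ, C, R, hX, hx₀, hΓ, hξ₀Γ, hcone, hC, hR, hlow⟩ := hinv
  obtain ⟨φ, hφ, hφc, hφ01, hφX, U, hU, hx₀U, hφ1⟩ := exists_smooth_cutoff hX hx₀
  obtain ⟨ψ, hψ, hψ01, hψΓ, hψR, hψt, Γ₁, hΓ₁, hξ₀Γ₁, hΓ₁cone, hψ1⟩ :=
    exists_directional_cutoff hΓ hcone hξ₀ hξ₀Γ hR
  have hlow' : ∀ x ∈ tsupport φ, ∀ ξ ∈ tsupport ψ, C * ω₀ x ξ ≤ ‖a x ξ‖ := fun x hx ξ hξ =>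
    hlow x (hφX hx) ξ (hψΓ hξ) (hψR ξ hξ)
  have hane : ∀ x ∈ tsupport φ, ∀ ξ ∈ tsupport ψ, a x ξ ≠ 0 := fun x hx ξ hξ =>
    norm_pos_iff.1 ((mul_pos hC (hω₀pos x ξ)).trans_le (hlow' x hx ξ hξ))
  have hab : ∀ x ξ, a x ξ * ((φ x : ℂ) * (ψ ξ : ℂ) / a x ξ) = (φ x : ℂ) * (ψ ξ : ℂ) := by
    intro x ξ
    by_cases hx : x ∈ tsupport φ
    · by_cases hξ : ξ ∈ tsupport ψ
      · exact mul_div_cancel₀ _ (hane x hx ξ hξ)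
      · simp [image_eq_zero_of_notMem_tsupport hξ]
    · simp [image_eq_zero_of_notMem_tsupport hx]
  refine ⟨fun x ξ => (φ x : ℂ) * (ψ ξ : ℂ) / a x ξ, φ, ψ, X, Γ, C⁻¹, R + 1, hX, hx₀, hΓ, hξ₀Γ,
    hcone, inv_pos.2 hC, by positivity, ?_, fun x ξ => ?_, fun x ξ h => ?_, hab, hφ, hφc, hφ01,
    hφX, ⟨U, hU, hx₀U, hφ1⟩, hψ, hψ01, hψΓ, hψt, ⟨Γ₁, hΓ₁, hξ₀Γ₁, hΓ₁cone, hψ1⟩,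
    U, Γ₁, R + 1, hU, hx₀U, hΓ₁, hξ₀Γ₁, hΓ₁cone, by positivity, fun x hx ξ hξ hξR => ?_⟩
  · refine ContDiff.div_of_ne_zero_on_tsupport (f := fun p => (φ p.1 : ℂ) * (ψ p.2 : ℂ)) ?_ ha
      fun p hp => ?_
    · exact (Complex.ofRealCLM.contDiff.comp (hφ.comp contDiff_fst)).mul
        (Complex.ofRealCLM.contDiff.comp (hψ.comp contDiff_snd))
    · have hp' : p ∈ tsupport φ ×ˢ tsupport ψ := by
        refine closure_minimal (fun q hq => ?_)
          ((isClosed_tsupport φ).prod (isClosed_tsupport ψ)) hp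
        exact ⟨subset_tsupport _ (Complex.ofReal_ne_zero.1 (left_ne_zero_of_mul hq)),
          subset_tsupport _ (Complex.ofReal_ne_zero.1 (right_ne_zero_of_mul hq))⟩
      exact hane p.1 hp'.1 p.2 hp'.2
  · have hω := hω₀pos x ξ
    by_cases hx : x ∈ tsupport φ
    · by_cases hξ : ξ ∈ tsupport ψ
      · rw [norm_div, norm_mul, Complex.norm_of_nonneg (hφ01 x).1,
          Complex.norm_of_nonneg (hψ01 ξ).1, inv_eq_one_div, div_div]
        exact div_le_div₀ zero_le_one (mul_le_one₀ (hφ01 x).2 (hψ01 ξ).1 (hψ01 ξ).2)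
          (by positivity) (hlow' x hx ξ hξ)
      · simp only [image_eq_zero_of_notMem_tsupport hξ, Complex.ofReal_zero, mul_zero, zero_div,
          norm_zero]
        positivity
    · simp only [image_eq_zero_of_notMem_tsupport hx, Complex.ofReal_zero, zero_mul, zero_div,
        norm_zero]
      positivity
  · rcases h with hx | hξ
    · simp [image_eq_zero_of_notMem_tsupport fun h => hx (hφX h)]
    · simp [image_eq_zero_of_notMem_tsupport fun h => hξ (hψΓ h)]
  · rw [hab, hφ1 x hx, hψ1 ξ hξ hξR]
    norm_num
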